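/- For any exponents γ, δ ≥ 0 there exists a constant C > 0, depending only on d, m_b, m_f, γ and δ (in particular independent of the integer n in the definition of g), such that for all λ ≥ 0 and all q ∈ ℝ^d: ∫_{ℝ^d} |g(k − q)|² / ( ω_b(k)^γ · (ω_b(k)+λ)^δ ) dk ≤ C · ‖g‖²_{L²} / ( ω_a(q)^γ · (ω_a(q)+λ)^δ ), where ‖g‖²_{L²} = ∫ |g(k)|² dk. -/

import Mathlib

open MeasureTheory

/-- The dispersion relation `ω(q) = sqrt(|q|² + m²)` on `ℝ^d`. -/
noncomputable def disp (d : ℕ) (m : ℝ) (q : EuclideanSpace ℝ (Fin d)) : ℝ :=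
  Real.sqrt (‖q‖ ^ 2 + m ^ 2)

/-- The rescaled spatial cutoff `g(k) = n^d f(n k)`. -/
noncomputable def cutG (d n : ℕ) (f : EuclideanSpace ℝ (Fin d) → ℝ)
    (x : EuclideanSpace ℝ (Fin d)) : ℝ :=
  (n : ℝ) ^ d * f ((n : ℝ) • x)

lemma disp_pos (d : ℕ) {m : ℝ} (hm : 0 < m) (q : EuclideanSpace ℝ (Fin d)) : 0 < disp d m q := by
  unfold disp
  positivity

lemma norm_le_disp (d : ℕ) (m : ℝ) (q : EuclideanSpace ℝ (Fin d)) : ‖q‖ ≤ disp d m q :=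
  Real.le_sqrt_of_sq_le (by nlinarith [sq_nonneg m])

lemma mass_le_disp (d : ℕ) (m : ℝ) (q : EuclideanSpace ℝ (Fin d)) : m ≤ disp d m q :=
  Real.le_sqrt_of_sq_le (by nlinarith [sq_nonneg ‖q‖])

lemma disp_le_norm_add (d : ℕ) {m : ℝ} (hm : 0 ≤ m) (q : EuclideanSpace ℝ (Fin d)) :
    disp d m q ≤ ‖q‖ + m :=
  Real.sqrt_le_iff.mpr ⟨by positivity, by nlinarith [mul_nonneg (norm_nonneg q) hm]⟩

/-- Dispersion relations of different masses are comparable at points of distance at most one. -/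
lemma disp_le_mul_disp (d : ℕ) {m m' : ℝ} (hm : 0 ≤ m) (hm' : 0 < m')
    {q k : EuclideanSpace ℝ (Fin d)} (h : ‖k - q‖ ≤ 1) :
    disp d m q ≤ (1 + (1 + m) / m') * disp d m' k := by
  have h1 : ‖q‖ ≤ ‖k‖ + 1 := by
    have := norm_sub_norm_le q k
    rw [norm_sub_rev] at this
    linarith
  have h2 : 1 + m ≤ (1 + m) / m' * disp d m' k := by
    rw [div_mul_eq_mul_div, le_div_iff₀ hm']
    exact mul_le_mul_of_nonneg_left (mass_le_disp d m' k) (by positivity)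
  linarith [disp_le_norm_add d hm q, norm_le_disp d m' k]

lemma weight_le_mul_weight {A a b γ δ lam : ℝ} (hA : 1 ≤ A) (ha : 0 < a) (hb : 0 < b)
    (hab : a ≤ A * b) (hγ : 0 ≤ γ) (hδ : 0 ≤ δ) (hlam : 0 ≤ lam) :
    a ^ γ * (a + lam) ^ δ ≤ A ^ γ * A ^ δ * (b ^ γ * (b + lam) ^ δ) := by
  have h1 : a ^ γ ≤ A ^ γ * b ^ γ := by
    rw [← Real.mul_rpow (by positivity) hb.le]
    exact Real.rpow_le_rpow ha.le hab hγ
  have h2 : (a + lam) ^ δ ≤ A ^ δ * (b + lam) ^ δ := by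
    rw [← Real.mul_rpow (by positivity) (by positivity)]
    exact Real.rpow_le_rpow (by positivity) (by nlinarith) hδ
  calc a ^ γ * (a + lam) ^ δ ≤ (A ^ γ * b ^ γ) * (A ^ δ * (b + lam) ^ δ) := by gcongr
    _ = _ := by ring

lemma norm_le_one_of_cutG_ne_zero {d n : ℕ} (hn : 1 ≤ n) {f : EuclideanSpace ℝ (Fin d) → ℝ}
    (hf : Function.support f ⊆ Metric.closedBall 0 1) {x : EuclideanSpace ℝ (Fin d)}
    (hx : cutG d n f x ≠ 0) : ‖x‖ ≤ 1 := by
  have h : (n : ℝ) • x ∈ Metric.closedBall 0 1 := hf (right_ne_zero_of_mul hx)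
  rw [mem_closedBall_zero_iff, norm_smul, Real.norm_natCast] at h
  have hn' : (1 : ℝ) ≤ n := by exact_mod_cast hn
  nlinarith [norm_nonneg x]

lemma integrable_cutG_sq {d n : ℕ} (hn : 1 ≤ n) {f : EuclideanSpace ℝ (Fin d) → ℝ}
    (hfm : Measurable f) (hf0 : ∀ x, 0 ≤ f x) {Cf : ℝ} (hfC : ∀ x, f x ≤ Cf)
    (hf : Function.support f ⊆ Metric.closedBall 0 1) :
    Integrable (fun x => cutG d n f x ^ 2) := by
  have hm : Measurable (fun x => cutG d n f x ^ 2) := by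
    unfold cutG
    fun_prop
  have hsupp : Function.support (fun x => cutG d n f x ^ 2) ⊆
      Metric.closedBall (0 : EuclideanSpace ℝ (Fin d)) 1 := fun x hx =>
    mem_closedBall_zero_iff.mpr (norm_le_one_of_cutG_ne_zero hn hf (ne_zero_pow two_ne_zero hx))
  rw [← integrableOn_iff_integrable_of_support_subset hsupp]
  refine Measure.integrableOn_of_bounded (M := ((n : ℝ) ^ d * Cf) ^ 2)
    measure_closedBall_lt_top.ne hm.aestronglyMeasurable (Filter.Eventually.of_forall fun x => ?_)
  rw [Real.norm_of_nonneg (sq_nonneg _)]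
  have := hf0 ((n : ℝ) • x)
  unfold cutG
  gcongr
  exact hfC _

/-- For exponents `γ, δ ≥ 0` there is a constant `C > 0` (depending only on `d`, the masses
and the exponents, and independent of `n`, `f`, `λ`, `q`) such that
`∫ |g(k-q)|²/(ω_b(k)^γ (ω_b(k)+λ)^δ) dk ≤ C ‖g‖² / (ω_a(q)^γ (ω_a(q)+λ)^δ)`. -/
theorem cutoff_convolution_bound_fermion
    (d : ℕ) (hd : 1 ≤ d) (m_b m_f : ℝ) (hmb : 0 < m_b) (hmf : 0 < m_f)
    (γ δ : ℝ) (hγ : 0 ≤ γ) (hδ : 0 ≤ δ) :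
    ∃ C : ℝ, 0 < C ∧
      ∀ (n : ℕ), 1 ≤ n →
      ∀ f : EuclideanSpace ℝ (Fin d) → ℝ,
        Measurable f → (∀ x, 0 ≤ f x) → (∃ Cf : ℝ, ∀ x, f x ≤ Cf) →
        Function.support f ⊆ Metric.closedBall 0 1 → (∫ x, f x) = 1 →
      ∀ lam : ℝ, 0 ≤ lam →
      ∀ q : EuclideanSpace ℝ (Fin d),
        (∫⁻ k, ENNReal.ofReal
            ((cutG d n f (k - q)) ^ 2 / (disp d m_f k ^ γ * (disp d m_f k + lam) ^ δ)))
          ≤ ENNReal.ofReal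
              (C * (∫ x, (cutG d n f x) ^ 2) /
                (disp d m_b q ^ γ * (disp d m_b q + lam) ^ δ)) := by
  have hA : 1 ≤ 1 + (1 + m_b) / m_f := le_add_of_nonneg_right (by positivity)
  refine ⟨(1 + (1 + m_b) / m_f) ^ γ * (1 + (1 + m_b) / m_f) ^ δ, by positivity, ?_⟩
  intro n hn f hfm hf0 ⟨Cf, hfC⟩ hf _ lam hlam q
  set A := 1 + (1 + m_b) / m_f
  have hq := disp_pos d hmb q
  set W := disp d m_b q ^ γ * (disp d m_b q + lam) ^ δ
  have hW : 0 < W := by positivity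
  have hpt : ∀ k, cutG d n f (k - q) ^ 2 / (disp d m_f k ^ γ * (disp d m_f k + lam) ^ δ)
      ≤ A ^ γ * A ^ δ / W * cutG d n f (k - q) ^ 2 := by
    intro k
    by_cases h0 : cutG d n f (k - q) = 0
    · simp [h0]
    have hk := disp_pos d hmf k
    have hw := weight_le_mul_weight hA hq hk
      (disp_le_mul_disp d hmb.le hmf (norm_le_one_of_cutG_ne_zero hn hf h0)) hγ hδ hlam
    rw [div_mul_eq_mul_div, div_le_div_iff₀ (by positivity) hW]
    calc cutG d n f (k - q) ^ 2 * W
        ≤ cutG d n f (k - q) ^ 2 *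
          (A ^ γ * A ^ δ * (disp d m_f k ^ γ * (disp d m_f k + lam) ^ δ)) := by gcongr
      _ = _ := by ring
  have hint := (((integrable_cutG_sq hn hfm hf0 hfC hf).comp_sub_right q).const_mul
    (A ^ γ * A ^ δ / W))
  calc _ ≤ ∫⁻ k, ENNReal.ofReal (A ^ γ * A ^ δ / W * cutG d n f (k - q) ^ 2) :=
        lintegral_mono fun k => ENNReal.ofReal_le_ofReal (hpt k)
    _ = ENNReal.ofReal (∫ k, A ^ γ * A ^ δ / W * cutG d n f (k - q) ^ 2) :=
        (ofReal_integral_eq_lintegral_ofReal hint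
          (Filter.Eventually.of_forall fun k => by positivity)).symm
    _ = _ := by
        rw [integral_const_mul, integral_sub_right_eq_self (fun x => cutG d n f x ^ 2) q,
          div_mul_eq_mul_div]
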